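/- Let 𝒜 be of nonstandard p(·)-growth with constants a₋, b⁺ and assume p⁻ > n. Let f : [0,∞) → [0,∞) be a continuous nonnegative strictly convex function. Suppose u ≥ 0 is a supersolution of div 𝒜(x,u,∇u) = f(u) in ℝⁿ satisfying the growth condition |u(x)| ≤ C|x|^{α} for all x with |x| ≥ 1, for some C > 0 and some α < p⁻/p⁺ − n/p⁺. Then u is constant. -/

import Mathlib

open MeasureTheory Metric Real
open scoped ContDiff

noncomputable section

abbrev Euc (n : ℕ) := EuclideanSpace ℝ (Fin n)

/-- Measure of the unit ball in `ℝⁿ`. -/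
def omegaEuc (n : ℕ) : ℝ := (volume (Metric.ball (0 : Euc n) 1)).toReal

/-- A measurable variable exponent `p` with `p⁻ = pm` and `p⁺ = pP`,
`1 < p⁻` and `p⁺ < ∞` (encoded by the a.e. bounds). -/
structure IsVarExp {n : ℕ} (p : Euc n → ℝ) (pm pP : ℝ) : Prop where
  meas : Measurable p
  one_lt : 1 < pm
  inf_eq : essInf p (volume : Measure (Euc n)) = pm
  sup_eq : essSup p (volume : Measure (Euc n)) = pP
  ae_lb : ∀ᵐ x ∂(volume : Measure (Euc n)), pm ≤ p x
  ae_ub : ∀ᵐ x ∂(volume : Measure (Euc n)), p x ≤ pP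

/-- `𝒜` is of nonstandard `p(·)`-growth with constants `am = a₋`, `bP = b⁺`. -/
structure IsNSGrowth {n : ℕ} (p : Euc n → ℝ) (𝒜 : Euc n → ℝ → Euc n → Euc n)
    (am bP : ℝ) : Prop where
  am_pos : 0 < am
  meas : ∀ (t : ℝ) (ξ : Euc n), Measurable (fun x => 𝒜 x t ξ)
  cont : ∀ x : Euc n, Continuous (fun tξ : ℝ × Euc n => 𝒜 x tξ.1 tξ.2)
  growth : ∃ a b : Euc n → ℝ, Measurable a ∧ Measurable b ∧
      (∀ x, am ≤ a x ∧ a x ≤ b x ∧ b x ≤ bP) ∧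
      (∀ x t ξ, a x * ‖ξ‖ ^ p x ≤ (inner ℝ (𝒜 x t ξ) ξ : ℝ)) ∧
      (∀ x t ξ, ‖𝒜 x t ξ‖ ≤ b x * ‖ξ‖ ^ (p x - 1))

/-- `u` is `𝒜`-harmonic in `ℝⁿ` (C¹ functions replace `W^{1,p(·)}_loc`). -/
def IsAHarmonic {n : ℕ} (p : Euc n → ℝ) (𝒜 : Euc n → ℝ → Euc n → Euc n)
    (u : Euc n → ℝ) : Prop :=
  ContDiff ℝ 1 u ∧
  LocallyIntegrable (fun x => ‖gradient u x‖ ^ p x) (volume : Measure (Euc n)) ∧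
  ∀ φ : Euc n → ℝ, ContDiff ℝ ∞ φ → HasCompactSupport φ →
    ∫ x, (inner ℝ (𝒜 x (u x) (gradient u x)) (gradient φ x) : ℝ) = 0

/-- `u` is an `𝒜`-subsolution in `ℝⁿ`. -/
def IsASubsolution {n : ℕ} (p : Euc n → ℝ) (𝒜 : Euc n → ℝ → Euc n → Euc n)
    (u : Euc n → ℝ) : Prop :=
  ContDiff ℝ 1 u ∧
  LocallyIntegrable (fun x => ‖gradient u x‖ ^ p x) (volume : Measure (Euc n)) ∧
  ∀ φ : Euc n → ℝ, ContDiff ℝ ∞ φ → HasCompactSupport φ → (∀ x, 0 ≤ φ x) →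
    ∫ x, (inner ℝ (𝒜 x (u x) (gradient u x)) (gradient φ x) : ℝ) ≤ 0

/-- `ℬ` is an admissible right-hand side. -/
structure IsAdmissibleRHS {n : ℕ} (p : Euc n → ℝ) (ℬ : Euc n → ℝ → Euc n → ℝ) : Prop where
  meas : ∀ (t : ℝ) (ξ : Euc n), Measurable (fun x => ℬ x t ξ)
  cont : ∀ x : Euc n, Continuous (fun tξ : ℝ × Euc n => ℬ x tξ.1 tξ.2)
  bound : ∃ c : Euc n → ℝ, Measurable c ∧ (∃ cP : ℝ, ∀ x, c x ≤ cP) ∧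
      ∀ x t ξ, |ℬ x t ξ| ≤ c x * (1 + ‖ξ‖ ^ (p x - 1))

/-- `u` is `(𝒜,ℬ)`-harmonic in `ℝⁿ`. -/
def IsABHarmonic {n : ℕ} (p : Euc n → ℝ) (𝒜 : Euc n → ℝ → Euc n → Euc n)
    (ℬ : Euc n → ℝ → Euc n → ℝ) (u : Euc n → ℝ) : Prop :=
  ContDiff ℝ 1 u ∧
  LocallyIntegrable (fun x => ‖gradient u x‖ ^ p x) (volume : Measure (Euc n)) ∧
  ∀ φ : Euc n → ℝ, ContDiff ℝ ∞ φ → HasCompactSupport φ →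
    ∫ x, (inner ℝ (𝒜 x (u x) (gradient u x)) (gradient φ x) : ℝ)
      = ∫ x, ℬ x (u x) (gradient u x) * φ x

/-- `u` is a supersolution of `div 𝒜(x,u,∇u) = f(u)` in `ℝⁿ`. -/
def IsFSupersolution {n : ℕ} (p : Euc n → ℝ) (𝒜 : Euc n → ℝ → Euc n → Euc n)
    (f : ℝ → ℝ) (u : Euc n → ℝ) : Prop :=
  ContDiff ℝ 1 u ∧
  LocallyIntegrable (fun x => ‖gradient u x‖ ^ p x) (volume : Measure (Euc n)) ∧
  ∀ φ : Euc n → ℝ, ContDiff ℝ ∞ φ → HasCompactSupport φ → (∀ x, 0 ≤ φ x) →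
    ∫ x, f (u x) * φ x ≤ - ∫ x, (inner ℝ (𝒜 x (u x) (gradient u x)) (gradient φ x) : ℝ)


/-- A nonnegative compactly supported `C¹` function is approximated by smooth ones, uniformly at
the level of the derivative and with supports in a fixed compact set. -/
theorem exists_smooth_nonneg_fderiv_dist_le {E : Type*} [NormedAddCommGroup E]
    [InnerProductSpace ℝ E] [FiniteDimensional ℝ E] [MeasurableSpace E] [BorelSpace E]
    {w : E → ℝ} (hw : ContDiff ℝ 1 w) (hwc : HasCompactSupport w) (hw0 : ∀ x, 0 ≤ w x)
    {ε : ℝ} (hε : 0 < ε) :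
    ∃ φ : E → ℝ, ContDiff ℝ ∞ φ ∧ HasCompactSupport φ ∧ (∀ x, 0 ≤ φ x) ∧
      (∀ x, ‖fderiv ℝ φ x - fderiv ℝ w x‖ ≤ ε) ∧
      ∀ x, x ∉ cthickening 1 (tsupport w) → fderiv ℝ φ x = 0 := by
  have hdc : Continuous (fderiv ℝ w) := hw.continuous_fderiv one_ne_zero
  have huc : UniformContinuous (fderiv ℝ w) :=
    (hwc.fderiv (𝕜 := ℝ)).uniformContinuous_of_continuous hdc
  obtain ⟨δ, hδ, hδε⟩ := Metric.uniformContinuous_iff.mp huc ε hε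
  have hr : 0 < min δ 1 := by positivity
  let ψ : ContDiffBump (0 : E) := ⟨min δ 1 / 2, min δ 1, half_pos hr, half_lt_self hr⟩
  have hψloc : LocallyIntegrable (ψ.normed volume) volume :=
    ψ.continuous_normed.locallyIntegrable
  let φ : E → ℝ := convolution (ψ.normed volume) w (ContinuousLinearMap.lsmul ℝ ℝ) volume
  have hderiv : ∀ x, fderiv ℝ φ x =
      convolution (ψ.normed volume) (fderiv ℝ w) (ContinuousLinearMap.lsmul ℝ ℝ) volume x :=
    fun x => (hwc.hasFDerivAt_convolution_right _ hψloc hw x).fderiv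
  refine ⟨φ, ?_, ?_, ?_, ?_, ?_⟩
  · exact ψ.hasCompactSupport_normed.contDiff_convolution_left _ ψ.contDiff_normed
      hw.continuous.locallyIntegrable
  · exact ψ.hasCompactSupport_normed.convolution _ hwc
  · intro x
    refine integral_nonneg fun t => ?_
    simpa using mul_nonneg (ψ.nonneg_normed t) (hw0 _)
  · intro x
    rw [← dist_eq_norm, hderiv]
    exact ψ.dist_normed_convolution_le hdc.aestronglyMeasurable fun y hy =>
      (hδε (lt_of_lt_of_le (mem_ball.mp hy) (min_le_left _ _))).le
  · intro x hx
    rw [hderiv, ψ.normed_convolution_eq_right]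
    · exact image_eq_zero_of_notMem_tsupport fun h =>
        hx (self_subset_cthickening _ (tsupport_fderiv_subset ℝ h))
    · have hz : ∀ y ∈ ball x ψ.rOut, fderiv ℝ w y = 0 := fun y hy =>
        image_eq_zero_of_notMem_tsupport fun h => hx <|
          mem_cthickening_of_dist_le x y 1 _ (tsupport_fderiv_subset ℝ h) <| by
            rw [dist_comm]; exact (lt_of_lt_of_le (mem_ball.mp hy) (min_le_right _ _)).le
      intro y hy
      rw [hz y hy, hz x (mem_ball_self ψ.rOut_pos)]

/-- The pairing of a locally integrable vector field with a continuous, compactly supported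
field of functionals is integrable. -/
theorem MeasureTheory.LocallyIntegrable.integrable_clm_apply {E : Type*} [NormedAddCommGroup E]
    [InnerProductSpace ℝ E] [FiniteDimensional ℝ E] [MeasurableSpace E] [BorelSpace E]
    {V : E → E} (hV : LocallyIntegrable V) {T : E → E →L[ℝ] ℝ} (hT : Continuous T)
    (hTc : HasCompactSupport T) : Integrable fun x => T x (V x) := by
  have hVn : LocallyIntegrable fun x => ‖V x‖ :=
    hV.mono hV.aestronglyMeasurable.norm (by simp)
  refine Integrable.mono' (hVn.integrable_smul_left_of_hasCompactSupport
    hT.norm hTc.norm) ?_ (Filter.Eventually.of_forall fun x => ?_)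
  · exact isBoundedBilinearMap_apply.continuous.comp_aestronglyMeasurable
      (hT.aestronglyMeasurable.prodMk hV.aestronglyMeasurable)
  · exact (T x).le_opNorm (V x)

/-- If the weak inequality `∫ ⟨V, ∇φ⟩ ≤ 0` holds for nonnegative smooth compactly supported test
functions, it holds for nonnegative `C¹` compactly supported ones. -/
theorem integral_fderiv_apply_nonpos_of_smooth {E : Type*} [NormedAddCommGroup E]
    [InnerProductSpace ℝ E] [FiniteDimensional ℝ E] [MeasurableSpace E] [BorelSpace E]
    {V : E → E} (hV : LocallyIntegrable V)
    (h : ∀ φ : E → ℝ, ContDiff ℝ ∞ φ → HasCompactSupport φ → (∀ x, 0 ≤ φ x) →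
      ∫ x, fderiv ℝ φ x (V x) ≤ 0)
    {w : E → ℝ} (hw : ContDiff ℝ 1 w) (hwc : HasCompactSupport w) (hw0 : ∀ x, 0 ≤ w x) :
    ∫ x, fderiv ℝ w x (V x) ≤ 0 := by
  set K := cthickening 1 (tsupport w)
  have hK : IsCompact K := hwc.isCompact.cthickening
  have hVK : IntegrableOn (fun x => ‖V x‖) K := (hV.integrableOn_isCompact hK).norm
  set I := ∫ x in K, ‖V x‖
  have hI : 0 ≤ I := integral_nonneg fun x => norm_nonneg _
  refine le_of_forall_pos_le_add fun ε hε => ?_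
  obtain ⟨φ, hφ, hφc, hφ0, hφw, hφK⟩ :=
    exists_smooth_nonneg_fderiv_dist_le hw hwc hw0 (ε := ε / (I + 1)) (by positivity)
  have hiw : Integrable fun x => fderiv ℝ w x (V x) :=
    hV.integrable_clm_apply (hw.continuous_fderiv one_ne_zero) (hwc.fderiv (𝕜 := ℝ))
  have hiφ : Integrable fun x => fderiv ℝ φ x (V x) :=
    hV.integrable_clm_apply (hφ.continuous_fderiv (by simp)) (hφc.fderiv (𝕜 := ℝ))
  have hind : Integrable (K.indicator fun x => ε / (I + 1) * ‖V x‖) :=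
    IntegrableOn.integrable_indicator (hVK.const_mul _) hK.measurableSet
  have hle : ∀ x, fderiv ℝ w x (V x) ≤
      fderiv ℝ φ x (V x) + K.indicator (fun x => ε / (I + 1) * ‖V x‖) x := by
    intro x
    by_cases hx : x ∈ K
    · rw [Set.indicator_of_mem hx]
      have h1 := (fderiv ℝ φ x - fderiv ℝ w x).le_of_opNorm_le (hφw x) (V x)
      have h2 := neg_le_of_abs_le (by simpa using h1)
      linarith
    · rw [Set.indicator_of_notMem hx, hφK x hx, image_eq_zero_of_notMem_tsupport fun h =>
        hx (self_subset_cthickening _ (tsupport_fderiv_subset ℝ h))]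
      simp
  calc ∫ x, fderiv ℝ w x (V x)
      ≤ ∫ x, (fderiv ℝ φ x (V x) + K.indicator (fun x => ε / (I + 1) * ‖V x‖) x) :=
        integral_mono hiw (hiφ.add hind) hle
    _ = (∫ x, fderiv ℝ φ x (V x)) + ε / (I + 1) * I := by
        rw [integral_add hiφ hind, integral_indicator hK.measurableSet, integral_const_mul]
    _ ≤ 0 + ε := by
        refine add_le_add (h φ hφ hφc hφ0) ?_
        rw [div_mul_eq_mul_div, div_le_iff₀ (by positivity)]
        nlinarith

/-- Young-type absorption with a constant uniform in the exponent. -/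
theorem mul_rpow_sub_one_mul_pow_le {a M g η Y p P : ℝ} {m : ℕ} (ha : 0 < a) (hM : 0 ≤ M)
    (hg : 0 ≤ g) (hη0 : 0 ≤ η) (hη1 : η ≤ 1) (hY : 0 ≤ Y) (hp : 1 < p) (hpP : p ≤ P)
    (hm : P ≤ m) :
    M * g ^ (p - 1) * η ^ (m - 1) * Y ≤
      a * g ^ p * η ^ m + M * max 1 (M / a) ^ P * Y ^ p := by
  have hm1 : 1 ≤ m := by
    have : (1 : ℝ) < m := by linarith
    exact_mod_cast this.le
  have hgp : g ^ (p - 1) * g = g ^ p := by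
    rw [← Real.rpow_add_one' hg (by linarith)]; ring_nf
  have hYp : Y ^ (p - 1) * Y = Y ^ p := by
    rw [← Real.rpow_add_one' hY (by linarith)]; ring_nf
  have hηm : η ^ (m - 1) * η = η ^ m := pow_sub_one_mul (by lia) η
  set L := max 1 (M / a)
  have hL1 : 1 ≤ L := le_max_left _ _
  rcases le_total (M * Y) (a * (g * η)) with hc | hc
  · have h1 : M * g ^ (p - 1) * η ^ (m - 1) * Y ≤ a * g ^ p * η ^ m := by
      calc M * g ^ (p - 1) * η ^ (m - 1) * Y = g ^ (p - 1) * η ^ (m - 1) * (M * Y) := by ring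
        _ ≤ g ^ (p - 1) * η ^ (m - 1) * (a * (g * η)) := by gcongr
        _ = a * (g ^ (p - 1) * g) * (η ^ (m - 1) * η) := by ring
        _ = _ := by rw [hgp, hηm]
    have : 0 ≤ M * L ^ P * Y ^ p := by positivity
    linarith
  · have hgη : g * η ≤ L * Y := by
      calc g * η ≤ M / a * Y := by
            rw [div_mul_eq_mul_div, le_div_iff₀ ha]; linarith
        _ ≤ L * Y := by gcongr; exact le_max_right _ _
    have hηle : η ^ (m - 1) ≤ η ^ (p - 1) := by
      rw [← Real.rpow_natCast η (m - 1)]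
      refine Real.rpow_le_rpow_of_exponent_ge_of_imp hη0 hη1 ?_ fun _ h => ?_
      · push_cast [hm1]; linarith
      · exfalso; push_cast [hm1] at h; linarith
    have h1 : M * g ^ (p - 1) * η ^ (m - 1) * Y ≤ M * L ^ P * Y ^ p := by
      calc M * g ^ (p - 1) * η ^ (m - 1) * Y ≤ M * g ^ (p - 1) * η ^ (p - 1) * Y := by gcongr
        _ = M * (g * η) ^ (p - 1) * Y := by rw [Real.mul_rpow hg hη0]; ring
        _ ≤ M * (L * Y) ^ (p - 1) * Y := by
            gcongr
        _ = M * L ^ (p - 1) * (Y ^ (p - 1) * Y) := by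
            rw [Real.mul_rpow (by positivity) hY]; ring
        _ ≤ M * L ^ P * (Y ^ (p - 1) * Y) := by
            gcongr
            linarith
        _ = _ := by rw [hYp]
    have : 0 ≤ a * g ^ p * η ^ m := by positivity
    linarith

theorem norm_gradient_eq_norm_fderiv {E : Type*} [NormedAddCommGroup E] [InnerProductSpace ℝ E]
    [CompleteSpace E] (w : E → ℝ) (x : E) : ‖gradient w x‖ = ‖fderiv ℝ w x‖ := by
  rw [← toDual_gradient, LinearIsometryEquiv.norm_map]

theorem ContDiff.continuous_gradient {E : Type*} [NormedAddCommGroup E] [InnerProductSpace ℝ E]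
    [CompleteSpace E] {w : E → ℝ} (hw : ContDiff ℝ 1 w) : Continuous (gradient w) :=
  (InnerProductSpace.toDual ℝ E).symm.continuous.comp (hw.continuous_fderiv one_ne_zero)

/-- The flux `𝒜(x, u, ∇u)` of a `C¹` function with locally finite energy is locally integrable. -/
theorem IsNSGrowth.locallyIntegrable_flux {n : ℕ} {p : Euc n → ℝ} {pm pP : ℝ}
    (hp : IsVarExp p pm pP) {𝒜 : Euc n → ℝ → Euc n → Euc n} {am bP : ℝ}
    (h𝒜 : IsNSGrowth p 𝒜 am bP) {u : Euc n → ℝ} (hu : ContDiff ℝ 1 u)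
    (hloc : LocallyIntegrable (fun x => ‖gradient u x‖ ^ p x) (volume : Measure (Euc n))) :
    LocallyIntegrable (fun x => 𝒜 x (u x) (gradient u x)) (volume : Measure (Euc n)) := by
  obtain ⟨a, b, -, -, hab, -, hb⟩ := h𝒜.growth
  have hmeas : Measurable fun x => 𝒜 x (u x) (gradient u x) := by
    have h := measurable_uncurry_of_continuous_of_measurable
      (u := fun (tξ : ℝ × Euc n) x => 𝒜 x tξ.1 tξ.2) h𝒜.cont (fun tξ => h𝒜.meas tξ.1 tξ.2)
    exact h.comp ((hu.continuous.measurable.prodMk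
      hu.continuous_gradient.measurable).prodMk measurable_id)
  have hbP : 0 ≤ bP := by
    have h := hab 0
    linarith [h𝒜.am_pos]
  refine (((locallyIntegrable_const (1 : ℝ)).add hloc).smul bP).mono
    hmeas.aestronglyMeasurable ?_
  filter_upwards [hp.ae_lb] with x hx
  have hp1 : 1 < p x := hp.one_lt.trans_le hx
  have hg : 0 ≤ ‖gradient u x‖ := norm_nonneg _
  have hpow : ‖gradient u x‖ ^ (p x - 1) ≤ 1 + ‖gradient u x‖ ^ p x := by
    rcases le_total ‖gradient u x‖ 1 with h | h
    · exact (Real.rpow_le_one hg h (by linarith)).trans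
        (le_add_of_nonneg_right (Real.rpow_nonneg hg _))
    · exact (Real.rpow_le_rpow_of_exponent_le h (by linarith)).trans
        (le_add_of_nonneg_left zero_le_one)
  calc ‖𝒜 x (u x) (gradient u x)‖ ≤ b x * ‖gradient u x‖ ^ (p x - 1) := hb x _ _
    _ ≤ bP * (1 + ‖gradient u x‖ ^ p x) :=
        mul_le_mul (hab x).2.2 hpow (Real.rpow_nonneg hg _) hbP
    _ ≤ _ := le_abs_self _

/-- Caccioppoli estimate for nonnegative functions `u` with `div 𝒜(x, u, ∇u) ≥ 0`, tested with
`u η ^ m`. -/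
theorem IsNSGrowth.caccioppoli {n : ℕ} {p : Euc n → ℝ} {pm pP : ℝ}
    (hp : IsVarExp p pm pP) {𝒜 : Euc n → ℝ → Euc n → Euc n} {am bP : ℝ}
    (h𝒜 : IsNSGrowth p 𝒜 am bP) {u : Euc n → ℝ} (hu : ContDiff ℝ 1 u)
    (hloc : LocallyIntegrable (fun x => ‖gradient u x‖ ^ p x) (volume : Measure (Euc n)))
    (hupos : ∀ x, 0 ≤ u x)
    (hweak : ∀ φ : Euc n → ℝ, ContDiff ℝ ∞ φ → HasCompactSupport φ → (∀ x, 0 ≤ φ x) →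
      ∫ x, fderiv ℝ φ x (𝒜 x (u x) (gradient u x)) ≤ 0)
    {m : ℕ} (hm : pP ≤ m) {η : Euc n → ℝ} (hη : ContDiff ℝ 1 η) (hηc : HasCompactSupport η)
    (hη0 : ∀ x, 0 ≤ η x) (hη1 : ∀ x, η x ≤ 1) {D : ℝ} (hD1 : D ≤ 1)
    (hD : ∀ x, u x * ‖fderiv ℝ η x‖ ≤ D) :
    am / 2 * ∫ x, ‖gradient u x‖ ^ p x * η x ^ m ≤
      m * bP * max 1 (m * bP / (am / 2)) ^ pP * D ^ pm * volume.real (tsupport η) := by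
  obtain ⟨a, b, -, -, hab, ha, hb⟩ := h𝒜.growth
  have ham : 0 < am := h𝒜.am_pos
  have hbP : 0 ≤ bP := by
    have h := hab 0
    linarith
  have hD0 : 0 ≤ D := (mul_nonneg (hupos 0) (norm_nonneg _)).trans (hD 0)
  have hm1 : m ≠ 0 := by
    rintro rfl
    obtain ⟨x, hx1, hx2⟩ := (hp.ae_lb.and hp.ae_ub).exists
    have := hp.one_lt
    push_cast at hm
    linarith
  set V : Euc n → Euc n := fun x => 𝒜 x (u x) (gradient u x)
  have hV : LocallyIntegrable V := h𝒜.locallyIntegrable_flux hp hu hloc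
  set w : Euc n → ℝ := fun x => u x * η x ^ m
  have hw : ContDiff ℝ 1 w := hu.mul (hη.pow m)
  have hηmc : HasCompactSupport fun x => η x ^ m :=
    hηc.comp_left (g := fun t : ℝ => t ^ m) (by simp [hm1])
  have hwc : HasCompactSupport w := hηmc.mul_left
  have hw0 : ∀ x, 0 ≤ w x := fun x => mul_nonneg (hupos x) (pow_nonneg (hη0 x) m)
  have hneg : ∫ x, fderiv ℝ w x (V x) ≤ 0 :=
    integral_fderiv_apply_nonpos_of_smooth hV hweak hw hwc hw0
  set C₀ : ℝ := m * bP * max 1 (m * bP / (am / 2)) ^ pP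
  have hC₀ : 0 ≤ C₀ := by positivity
  have hS : IsCompact (tsupport η) := hηc
  have hfd : ∀ x, fderiv ℝ w x (V x) = η x ^ m * fderiv ℝ u x (V x) +
      u x * (m * η x ^ (m - 1) * fderiv ℝ η x (V x)) := by
    intro x
    have h1 := (hu.differentiable one_ne_zero x).hasFDerivAt.mul
      ((hη.differentiable one_ne_zero x).hasFDerivAt.pow m)
    have h2 : fderiv ℝ w x = _ := h1.fderiv
    rw [h2]
    simp
    ring
  have hpt : ∀ᵐ x, am / 2 * (‖gradient u x‖ ^ p x * η x ^ m) ≤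
      fderiv ℝ w x (V x) + (tsupport η).indicator (fun _ => C₀ * D ^ pm) x := by
    filter_upwards [hp.ae_lb, hp.ae_ub] with x hx1 hx2
    have hp1 : 1 < p x := hp.one_lt.trans_le hx1
    set g := ‖gradient u x‖
    have hg : 0 ≤ g := norm_nonneg _
    set Y := u x * ‖fderiv ℝ η x‖
    have hY0 : 0 ≤ Y := mul_nonneg (hupos x) (norm_nonneg _)
    have hηx := hη0 x
    have hYoung : m * bP * g ^ (p x - 1) * η x ^ (m - 1) * Y ≤
        am / 2 * g ^ p x * η x ^ m + C₀ * Y ^ p x :=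
      mul_rpow_sub_one_mul_pow_le (half_pos ham)
        (mul_nonneg m.cast_nonneg hbP) hg (hη0 x) (hη1 x) hY0 hp1 hx2 hm
    have hell : am * g ^ p x ≤ fderiv ℝ u x (V x) := by
      have h1 := ha x (u x) (gradient u x)
      rw [real_inner_comm, inner_gradient_left] at h1
      exact (mul_le_mul_of_nonneg_right (hab x).1 (Real.rpow_nonneg hg _)).trans h1
    have hVx : ‖V x‖ ≤ bP * g ^ (p x - 1) := (hb x _ _).trans
      (mul_le_mul_of_nonneg_right (hab x).2.2 (Real.rpow_nonneg hg _))
    have hcross : -(m * bP * g ^ (p x - 1) * η x ^ (m - 1) * Y) ≤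
        u x * (m * η x ^ (m - 1) * fderiv ℝ η x (V x)) := by
      have h1 : -(‖fderiv ℝ η x‖ * (bP * g ^ (p x - 1))) ≤ fderiv ℝ η x (V x) :=
        neg_le_of_abs_le <| ((fderiv ℝ η x).le_opNorm (V x)).trans <|
          mul_le_mul_of_nonneg_left hVx (norm_nonneg _)
      calc -(m * bP * g ^ (p x - 1) * η x ^ (m - 1) * Y)
          = u x * (m * η x ^ (m - 1)) * -(‖fderiv ℝ η x‖ * (bP * g ^ (p x - 1))) := by
            simp only [Y]; ring
        _ ≤ u x * (m * η x ^ (m - 1)) * fderiv ℝ η x (V x) :=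
            mul_le_mul_of_nonneg_left h1
              (mul_nonneg (hupos x) (mul_nonneg m.cast_nonneg (pow_nonneg hηx _)))
        _ = _ := by ring
    have hYp : C₀ * Y ^ p x ≤ (tsupport η).indicator (fun _ => C₀ * D ^ pm) x := by
      by_cases hx : x ∈ tsupport η
      · rw [Set.indicator_of_mem hx]
        refine mul_le_mul_of_nonneg_left ?_ hC₀
        calc Y ^ p x ≤ D ^ p x := Real.rpow_le_rpow hY0 (hD x) (by linarith)
          _ ≤ D ^ pm := Real.rpow_le_rpow_of_exponent_ge_of_imp hD0 hD1 hx1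
              fun _ h => by linarith [hp.one_lt]
      · have : fderiv ℝ η x = 0 :=
          image_eq_zero_of_notMem_tsupport fun h => hx (tsupport_fderiv_subset ℝ h)
        rw [Set.indicator_of_notMem hx]
        simp only [Y, this, norm_zero, mul_zero]
        rw [Real.zero_rpow (by linarith), mul_zero]
    have hmain := mul_le_mul_of_nonneg_left hell (pow_nonneg hηx m)
    rw [hfd]
    linarith
  have hiw : Integrable fun x => fderiv ℝ w x (V x) :=
    hV.integrable_clm_apply (hw.continuous_fderiv one_ne_zero) (hwc.fderiv (𝕜 := ℝ))
  have hind : Integrable ((tsupport η).indicator fun _ => C₀ * D ^ pm) :=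
    (integrableOn_const hS.measure_lt_top.ne).integrable_indicator hS.measurableSet
  have hil : Integrable fun x => ‖gradient u x‖ ^ p x * η x ^ m := by
    simpa [mul_comm] using hloc.integrable_smul_left_of_hasCompactSupport
      (hη.continuous.pow m) hηmc
  calc am / 2 * ∫ x, ‖gradient u x‖ ^ p x * η x ^ m
      = ∫ x, am / 2 * (‖gradient u x‖ ^ p x * η x ^ m) := (integral_const_mul _ _).symm
    _ ≤ ∫ x, (fderiv ℝ w x (V x) + (tsupport η).indicator (fun _ => C₀ * D ^ pm) x) :=
        integral_mono_ae (hil.const_mul _) (hiw.add hind) hpt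
    _ = (∫ x, fderiv ℝ w x (V x)) + C₀ * D ^ pm * volume.real (tsupport η) := by
        rw [integral_add hiw hind, integral_indicator_const _ hS.measurableSet, smul_eq_mul,
          mul_comm (volume.real _)]
    _ ≤ _ := by linarith

/-- Smooth cutoffs: `η = 1` on the closed ball of radius `R`, supported in the closed ball of radius
`2 R`, with derivative bounded by `K / R` and vanishing in the open ball of radius `R`. -/
theorem exists_cutoff (E : Type*) [NormedAddCommGroup E] [InnerProductSpace ℝ E]
    [FiniteDimensional ℝ E] :
    ∃ K : ℝ, 0 ≤ K ∧ ∀ R : ℝ, 0 < R → ∃ η : E → ℝ, ContDiff ℝ 1 η ∧ HasCompactSupport η ∧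
      (∀ x, 0 ≤ η x) ∧ (∀ x, η x ≤ 1) ∧ (∀ x ∈ closedBall (0 : E) R, η x = 1) ∧
      tsupport η ⊆ closedBall 0 (2 * R) ∧ (∀ x, ‖fderiv ℝ η x‖ ≤ K / R) ∧
      ∀ x ∈ ball (0 : E) R, fderiv ℝ η x = 0 := by
  let ψ : ContDiffBump (0 : E) := ⟨1, 2, one_pos, one_lt_two⟩
  obtain ⟨K, hK⟩ := (ψ.contDiff (n := 1)).continuous_fderiv one_ne_zero
    |>.bounded_above_of_compact_support (ψ.hasCompactSupport.fderiv (𝕜 := ℝ))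
  refine ⟨K, (norm_nonneg _).trans (hK 0), fun R hR => ?_⟩
  have hRi : 0 < R⁻¹ := inv_pos.mpr hR
  have hone : ∀ x ∈ closedBall (0 : E) R, ψ (R⁻¹ • x) = 1 := fun x hx =>
    ψ.one_of_mem_closedBall <| by
      rw [mem_closedBall_zero_iff] at hx ⊢
      rw [norm_smul, Real.norm_of_nonneg hRi.le, inv_mul_le_iff₀ hR]
      simpa [ψ] using hx
  have hsupp : tsupport (fun x : E => ψ (R⁻¹ • x)) ⊆ closedBall 0 (2 * R) := by
    refine closure_minimal (fun x hx => ?_) isClosed_closedBall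
    by_contra hxR
    refine hx (ψ.zero_of_le_dist ?_)
    rw [mem_closedBall_zero_iff, not_le] at hxR
    rw [dist_zero_right, norm_smul, Real.norm_of_nonneg hRi.le, le_inv_mul_iff₀ hR]
    simpa [ψ, mul_comm] using hxR.le
  refine ⟨fun x => ψ (R⁻¹ • x), ψ.contDiff.comp (contDiff_const_smul _),
    (isCompact_closedBall _ _).of_isClosed_subset (isClosed_tsupport _) hsupp,
    fun x => ψ.nonneg, fun x => ψ.le_one, hone, hsupp, fun x => ?_, fun x hx => ?_⟩
  · rw [fderiv_comp_smul, norm_smul, Real.norm_of_nonneg hRi.le, div_eq_inv_mul]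
    exact mul_le_mul_of_nonneg_left (hK _) hRi.le
  · have h1 : (fun x : E => ψ (R⁻¹ • x)) =ᶠ[nhds x] fun _ => (1 : ℝ) := by
      filter_upwards [isOpen_ball.mem_nhds hx] with y hy
      exact hone y (ball_subset_closedBall hy)
    rw [h1.fderiv_eq, fderiv_fun_const, Pi.zero_apply]

open Filter Topology

/-- Corollary 4.14: let `p⁻ > n` and let `f : [0,∞) → [0,∞)` be continuous, nonnegative
and strictly convex. If `u ≥ 0` is a supersolution of `div 𝒜(x,u,∇u) = f(u)` in `ℝⁿ`
with `|u(x)| ≤ C|x|^α` for `|x| ≥ 1`, where `C > 0` and `α < p⁻/p⁺ − n/p⁺`,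
then `u` is constant. -/
theorem liouville_supersolution_growth {n : ℕ} (p : Euc n → ℝ) (pm pP : ℝ)
    (hp : IsVarExp p pm pP) (hpn : (n : ℝ) < pm)
    (𝒜 : Euc n → ℝ → Euc n → Euc n) (am bP : ℝ)
    (h𝒜 : IsNSGrowth p 𝒜 am bP)
    (f : ℝ → ℝ) (hfc : ContinuousOn f (Set.Ici 0)) (hf0 : ∀ t ∈ Set.Ici (0 : ℝ), 0 ≤ f t)
    (hconv : StrictConvexOn ℝ (Set.Ici 0) f)
    (u : Euc n → ℝ) (hu : IsFSupersolution p 𝒜 f u) (hupos : ∀ x, 0 ≤ u x)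
    (C : ℝ) (hC : 0 < C) (α : ℝ) (hα : α < pm / pP - (n : ℝ) / pP)
    (hgrowth : ∀ x : Euc n, 1 ≤ ‖x‖ → |u x| ≤ C * ‖x‖ ^ α) :
    ∃ c : ℝ, ∀ x, u x = c := by
  obtain ⟨hu1, hloc, hsuper⟩ := hu
  have hweak : ∀ φ : Euc n → ℝ, ContDiff ℝ ∞ φ → HasCompactSupport φ → (∀ x, 0 ≤ φ x) →
      ∫ x, fderiv ℝ φ x (𝒜 x (u x) (gradient u x)) ≤ 0 := by
    intro φ hφ hφc hφ0
    have h1 := hsuper φ hφ hφc hφ0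
    have h2 : 0 ≤ ∫ x, f (u x) * φ x :=
      integral_nonneg fun x => mul_nonneg (hf0 _ (hupos x)) (hφ0 x)
    simp only [inner_gradient_right, conj_trivial] at h1
    linarith
  have ham : 0 < am := h𝒜.am_pos
  have hbP : 0 ≤ bP := by
    obtain ⟨a, b, -, -, hab, -⟩ := h𝒜.growth
    have h := hab 0
    linarith
  have hpm : 1 < pm := hp.one_lt
  have hpmP : pm ≤ pP := by
    obtain ⟨x, hx1, hx2⟩ := (hp.ae_lb.and hp.ae_ub).exists
    exact hx1.trans hx2
  set β : ℝ := max α 0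
  have hβ0 : 0 ≤ β := le_max_right _ _
  have hβ : (β - 1) * pm + n < 0 := by
    have h1 : β < (pm - n) / pP := by
      rw [sub_div]
      refine max_lt hα ?_
      rw [← sub_div]
      exact div_pos (by linarith) (by linarith)
    have h2 : β * pP < pm - n := (lt_div_iff₀ (by linarith)).mp h1
    have h3 : β * pm ≤ β * pP := mul_le_mul_of_nonneg_left hpmP hβ0
    linarith
  have hβ1 : β - 1 < 0 := by
    have : (0 : ℝ) ≤ n := n.cast_nonneg
    nlinarith
  obtain ⟨K, hK0, hcut⟩ := exists_cutoff (Euc n)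
  obtain ⟨m, hm⟩ := exists_nat_ge pP
  set A : ℝ := C * 2 ^ β * K
  have hA : 0 ≤ A := by positivity
  set C₀ : ℝ := m * bP * max 1 (m * bP / (am / 2)) ^ pP
  have hC₀ : 0 ≤ C₀ := by positivity
  set ν : ℝ := volume.real (ball (0 : Euc n) 1)
  have hDlim : Tendsto (fun R : ℝ => A * R ^ (β - 1)) atTop (𝓝 0) := by
    have h := (tendsto_rpow_neg_atTop (y := 1 - β) (by linarith)).const_mul A
    simpa using h
  have hFlim : Tendsto (fun R : ℝ => C₀ * A ^ pm * 2 ^ n * ν * R ^ ((β - 1) * pm + n))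
      atTop (𝓝 0) := by
    have h := (tendsto_rpow_neg_atTop (y := -((β - 1) * pm + n)) (by linarith)).const_mul
      (C₀ * A ^ pm * 2 ^ n * ν)
    simpa only [neg_neg, mul_zero] using h
  have henergy : ∀ R₀ : ℝ, am / 2 * ∫ x in closedBall (0 : Euc n) R₀, ‖gradient u x‖ ^ p x ≤ 0 := by
    intro R₀
    refine ge_of_tendsto hFlim ?_
    filter_upwards [eventually_ge_atTop 1, eventually_ge_atTop R₀,
      hDlim.eventually_le_const one_pos] with R hR1 hRR₀ hD1
    have hR0 : 0 < R := by linarith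
    obtain ⟨η, hη, hηc, hη0, hη1, hηone, hηsupp, hηK, hηzero⟩ := hcut R hR0
    have hD0 : 0 ≤ A * R ^ (β - 1) := by positivity
    have hD : ∀ x, u x * ‖fderiv ℝ η x‖ ≤ A * R ^ (β - 1) := by
      intro x
      by_cases hxs : x ∈ tsupport η
      · by_cases hxR : x ∈ ball (0 : Euc n) R
        · simpa [hηzero x hxR] using hD0
        · rw [mem_ball_zero_iff, not_lt] at hxR
          have hx2 : ‖x‖ ≤ 2 * R := by simpa using hηsupp hxs
          have hx1 : 1 ≤ ‖x‖ := hR1.trans hxR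
          have hux : u x ≤ C * (2 ^ β * R ^ β) :=
            calc u x ≤ C * ‖x‖ ^ α := (le_abs_self _).trans (hgrowth x hx1)
              _ ≤ C * ‖x‖ ^ β := by
                  gcongr
                  exact le_max_left _ _
              _ ≤ C * (2 * R) ^ β := by gcongr
              _ = C * (2 ^ β * R ^ β) := by rw [Real.mul_rpow two_pos.le hR0.le]
          calc u x * ‖fderiv ℝ η x‖ ≤ C * (2 ^ β * R ^ β) * (K / R) :=
                mul_le_mul hux (hηK x) (norm_nonneg _) (by positivity)
            _ = A * R ^ (β - 1) := by
                rw [Real.rpow_sub_one hR0.ne']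
                simp only [A]
                ring
      · have : fderiv ℝ η x = 0 :=
          image_eq_zero_of_notMem_tsupport fun h => hxs (tsupport_fderiv_subset ℝ h)
        simpa [this] using hD0
    have hcacc := h𝒜.caccioppoli hp hu1 hloc hupos hweak hm hη hηc hη0 hη1 hD1 hD
    have hvol : volume.real (tsupport η) ≤ (2 * R) ^ n * ν := by
      refine (measureReal_mono hηsupp measure_closedBall_lt_top.ne).trans_eq ?_
      rw [Measure.addHaar_real_closedBall _ _ (by positivity), finrank_euclideanSpace_fin]
    have hint : Integrable fun x => ‖gradient u x‖ ^ p x * η x ^ m := by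
      have hm0 : m ≠ 0 := by
        rintro rfl
        push_cast at hm
        linarith
      simpa [mul_comm] using hloc.integrable_smul_left_of_hasCompactSupport
        (hη.continuous.pow m) (hηc.comp_left (g := fun t : ℝ => t ^ m) (by simp [hm0]))
    have hle : ∫ x in closedBall (0 : Euc n) R₀, ‖gradient u x‖ ^ p x ≤
        ∫ x, ‖gradient u x‖ ^ p x * η x ^ m := by
      calc ∫ x in closedBall (0 : Euc n) R₀, ‖gradient u x‖ ^ p x
          = ∫ x in closedBall (0 : Euc n) R₀, ‖gradient u x‖ ^ p x * η x ^ m :=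
            setIntegral_congr_fun measurableSet_closedBall fun x hx => by
              simp [hηone x (closedBall_subset_closedBall hRR₀ hx)]
        _ ≤ _ := setIntegral_le_integral hint <| Filter.Eventually.of_forall fun x =>
            mul_nonneg (Real.rpow_nonneg (norm_nonneg _) _) (pow_nonneg (hη0 x) m)
    calc am / 2 * ∫ x in closedBall (0 : Euc n) R₀, ‖gradient u x‖ ^ p x
        ≤ am / 2 * ∫ x, ‖gradient u x‖ ^ p x * η x ^ m := by gcongr
      _ ≤ C₀ * (A * R ^ (β - 1)) ^ pm * volume.real (tsupport η) := hcacc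
      _ ≤ C₀ * (A * R ^ (β - 1)) ^ pm * ((2 * R) ^ n * ν) := by gcongr
      _ = _ := by
        rw [Real.mul_rpow hA (by positivity), ← Real.rpow_mul hR0.le, mul_pow,
          Real.rpow_add hR0, Real.rpow_natCast]
        ring
  have hnonneg : ∀ x, 0 ≤ ‖gradient u x‖ ^ p x := fun x => Real.rpow_nonneg (norm_nonneg _) _
  have hzero : ∀ N : ℕ, ∀ᵐ x, x ∈ closedBall (0 : Euc n) N → ‖gradient u x‖ ^ p x = 0 := by
    intro N
    have hint : IntegrableOn (fun x => ‖gradient u x‖ ^ p x) (closedBall (0 : Euc n) N) :=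
      hloc.integrableOn_isCompact (isCompact_closedBall _ _)
    have hI : ∫ x in closedBall (0 : Euc n) N, ‖gradient u x‖ ^ p x = 0 :=
      le_antisymm (nonpos_of_mul_nonpos_right (henergy N) (half_pos ham))
        (integral_nonneg hnonneg)
    exact (ae_restrict_iff' measurableSet_closedBall).mp
      ((integral_eq_zero_iff_of_nonneg hnonneg hint).mp hI)
  have hfd : (fun x => fderiv ℝ u x) = fun _ => 0 := by
    refine (Continuous.ae_eq_iff_eq volume (hu1.continuous_fderiv one_ne_zero)
      continuous_const).mp ?_
    filter_upwards [ae_all_iff.mpr hzero, hp.ae_lb] with x hx hpx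
    obtain ⟨N, hN⟩ := exists_nat_ge ‖x‖
    have h := hx N (mem_closedBall_zero_iff.mpr hN)
    rw [Real.rpow_eq_zero (norm_nonneg _) (by linarith), norm_gradient_eq_norm_fderiv] at h
    exact norm_eq_zero.mp h
  exact ⟨u 0, fun x => is_const_of_fderiv_eq_zero (hu1.differentiable one_ne_zero)
    (fun y => congrFun hfd y) x 0⟩

end
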